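/- Assume each E_t has full column rank, i.e. E_tᵀE_t is invertible (equivalently, E_t is injective as a linear map). For every tuple of causal disturbance/belief feedback policies Ψ_t : (ℝ^d)^{t−1} × (ℝ^q)^t → ℝ^m (giving inputs u_t = Ψ_t(ξ^{t−1}, ζ^t)) there exists a tuple of causal state/belief feedback policies ψ_t : (ℝ^n)^t × (ℝ^q)^t → ℝ^m (giving inputs u_t = ψ_t(x^t, ζ^t)) such that for every disturbance sequence ξ ∈ (ℝ^d)^T and every belief sequence ζ ∈ (ℝ^q)^T the two closed-loop systems produce identical state trajectories and identical input trajectories. -/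

import Mathlib

open Matrix

/-- The closed-loop dynamics `x_{t+1} = Aₜ xₜ + Bₜ ζₜ + Dₜ uₜ + Eₜ ξₜ` with initial state
`xInit`, for given disturbance, belief and input sequences (`0`-based time indexing:
stage `k : Fin T` of the recursion corresponds to time `t = k+1` of the paper). -/
def Dyn (T n m d q : ℕ) (xInit : Fin n → ℝ)
    (A : Fin T → Matrix (Fin n) (Fin n) ℝ)
    (B : Fin T → Matrix (Fin n) (Fin q) ℝ)
    (D : Fin T → Matrix (Fin n) (Fin m) ℝ)
    (E : Fin T → Matrix (Fin n) (Fin d) ℝ)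
    (ξ : Fin T → Fin d → ℝ) (ζ : Fin T → Fin q → ℝ)
    (x : Fin (T+1) → Fin n → ℝ) (u : Fin T → Fin m → ℝ) : Prop :=
  x 0 = xInit ∧
    ∀ k : Fin T,
      x k.succ = A k *ᵥ x k.castSucc + B k *ᵥ ζ k + D k *ᵥ u k + E k *ᵥ ξ k


/-- One sweep of disturbance estimation: at every stage, solve the dynamics for the disturbance by
least squares, evaluating the policy `Ψ` at the current estimate `η`. -/
noncomputable def disturbanceSweep {T n m d q : ℕ}
    (A : Fin T → Matrix (Fin n) (Fin n) ℝ)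
    (B : Fin T → Matrix (Fin n) (Fin q) ℝ)
    (D : Fin T → Matrix (Fin n) (Fin m) ℝ)
    (E : Fin T → Matrix (Fin n) (Fin d) ℝ)
    (Ψ : Fin T → (Fin T → Fin d → ℝ) → (Fin T → Fin q → ℝ) → Fin m → ℝ)
    (x : Fin (T+1) → Fin n → ℝ) (ζ : Fin T → Fin q → ℝ)
    (η : Fin T → Fin d → ℝ) (s : Fin T) : Fin d → ℝ :=
  (((E s)ᵀ * E s)⁻¹ * (E s)ᵀ) *ᵥ
    (x s.succ - (A s *ᵥ x s.castSucc + B s *ᵥ ζ s + D s *ᵥ Ψ s η ζ))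

theorem leftInverse_mulVec_mulVec {n d : ℕ} {E : Matrix (Fin n) (Fin d) ℝ}
    (hE : IsUnit (Eᵀ * E)) (v : Fin d → ℝ) :
    ((Eᵀ * E)⁻¹ * Eᵀ) *ᵥ (E *ᵥ v) = v := by
  rw [mulVec_mulVec, Matrix.mul_assoc,
    Matrix.nonsing_inv_mul _ ((Matrix.isUnit_iff_isUnit_det _).1 hE), one_mulVec]

section Sweep

variable {T n m d q : ℕ}
  {A : Fin T → Matrix (Fin n) (Fin n) ℝ} {B : Fin T → Matrix (Fin n) (Fin q) ℝ}
  {D : Fin T → Matrix (Fin n) (Fin m) ℝ} {E : Fin T → Matrix (Fin n) (Fin d) ℝ}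
  {Ψ : Fin T → (Fin T → Fin d → ℝ) → (Fin T → Fin q → ℝ) → Fin m → ℝ}

/-- Iterated sweeps are causal: before stage `k` they only see states and beliefs up to `k`. -/
theorem disturbanceSweep_iterate_congr
    (hΨ : ∀ (k : Fin T) (ξ ξ' : Fin T → Fin d → ℝ) (ζ ζ' : Fin T → Fin q → ℝ),
      (∀ s : Fin T, (s : ℕ) < (k : ℕ) → ξ s = ξ' s) →
      (∀ s : Fin T, (s : ℕ) ≤ (k : ℕ) → ζ s = ζ' s) →
      Ψ k ξ ζ = Ψ k ξ' ζ')
    {k : ℕ} {x x' : Fin (T+1) → Fin n → ℝ} {ζ ζ' : Fin T → Fin q → ℝ}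
    (hx : ∀ s : Fin (T+1), (s : ℕ) ≤ k → x s = x' s)
    (hζ : ∀ s : Fin T, (s : ℕ) ≤ k → ζ s = ζ' s)
    (j : ℕ) (s : Fin T) (hs : (s : ℕ) < k) :
    (disturbanceSweep A B D E Ψ x ζ)^[j] 0 s = (disturbanceSweep A B D E Ψ x' ζ')^[j] 0 s := by
  induction j generalizing s with
  | zero => rfl
  | succ j ih =>
    rw [Function.iterate_succ_apply', Function.iterate_succ_apply', disturbanceSweep,
      disturbanceSweep, hx s.succ hs, hx s.castSucc hs.le, hζ s hs.le,
      hΨ s _ _ ζ ζ' (fun r hr => ih r (hr.trans hs)) (fun r hr => hζ r (hr.trans hs.le))]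

/-- Along a closed-loop trajectory, `j` sweeps recover the first `j` disturbances. -/
theorem disturbanceSweep_iterate_eq
    (hE : ∀ k : Fin T, IsUnit ((E k)ᵀ * E k))
    (hΨ : ∀ (k : Fin T) (ξ ξ' : Fin T → Fin d → ℝ) (ζ ζ' : Fin T → Fin q → ℝ),
      (∀ s : Fin T, (s : ℕ) < (k : ℕ) → ξ s = ξ' s) →
      (∀ s : Fin T, (s : ℕ) ≤ (k : ℕ) → ζ s = ζ' s) →
      Ψ k ξ ζ = Ψ k ξ' ζ')
    {xInit : Fin n → ℝ} {ξ : Fin T → Fin d → ℝ} {ζ : Fin T → Fin q → ℝ}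
    {x : Fin (T+1) → Fin n → ℝ} {u : Fin T → Fin m → ℝ}
    (hdyn : Dyn T n m d q xInit A B D E ξ ζ x u)
    (hu : ∀ k, u k = Ψ k ((disturbanceSweep A B D E Ψ x ζ)^[k] 0) ζ)
    (j : ℕ) (s : Fin T) (hs : (s : ℕ) < j) :
    (disturbanceSweep A B D E Ψ x ζ)^[j] 0 s = ξ s := by
  induction j using Nat.strong_induction_on generalizing s with
  | _ j ih =>
    obtain ⟨i, rfl⟩ : ∃ i, j = i + 1 := ⟨j - 1, by omega⟩
    have hpolicy : Ψ s ((disturbanceSweep A B D E Ψ x ζ)^[i] 0) ζ = u s := by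
      rw [hu s]
      refine hΨ s _ _ ζ ζ (fun r hr => ?_) (fun _ _ => rfl)
      rw [ih i (by omega) r (by omega), ih s hs r hr]
    rw [Function.iterate_succ_apply', disturbanceSweep, hpolicy, hdyn.2 s, add_sub_cancel_left,
      leftInverse_mulVec_mulVec (hE s)]

end Sweep

/-- The dynamics determine the state trajectory from the inputs. -/
theorem Dyn.state_unique {T n m d q : ℕ} {xInit : Fin n → ℝ}
    {A : Fin T → Matrix (Fin n) (Fin n) ℝ} {B : Fin T → Matrix (Fin n) (Fin q) ℝ}
    {D : Fin T → Matrix (Fin n) (Fin m) ℝ} {E : Fin T → Matrix (Fin n) (Fin d) ℝ}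
    {ξ : Fin T → Fin d → ℝ} {ζ : Fin T → Fin q → ℝ}
    {x x' : Fin (T+1) → Fin n → ℝ} {u : Fin T → Fin m → ℝ}
    (h : Dyn T n m d q xInit A B D E ξ ζ x u) (h' : Dyn T n m d q xInit A B D E ξ ζ x' u) :
    x = x' := by
  funext k
  induction k using Fin.induction with
  | zero => rw [h.1, h'.1]
  | succ k ih => rw [h.2 k, h'.2 k, ih]

/-- converse direction of Theorem 2: if every `Eₜ` has full column rank
(`EₜᵀEₜ` invertible), then every causal disturbance/belief feedback policy `Ψ` admits a
causal state/belief feedback policy `ψ` producing the same closed-loop state and input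
trajectories for every disturbance and belief sequence. -/
theorem stmt2 (T n m d q : ℕ) (xInit : Fin n → ℝ)
    (A : Fin T → Matrix (Fin n) (Fin n) ℝ)
    (B : Fin T → Matrix (Fin n) (Fin q) ℝ)
    (D : Fin T → Matrix (Fin n) (Fin m) ℝ)
    (E : Fin T → Matrix (Fin n) (Fin d) ℝ)
    (hE : ∀ k : Fin T, IsUnit ((E k)ᵀ * E k))
    (Ψ : Fin T → (Fin T → Fin d → ℝ) → (Fin T → Fin q → ℝ) → Fin m → ℝ)
    (hΨ : ∀ (k : Fin T) (ξ ξ' : Fin T → Fin d → ℝ) (ζ ζ' : Fin T → Fin q → ℝ),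
      (∀ s : Fin T, (s : ℕ) < (k : ℕ) → ξ s = ξ' s) →
      (∀ s : Fin T, (s : ℕ) ≤ (k : ℕ) → ζ s = ζ' s) →
      Ψ k ξ ζ = Ψ k ξ' ζ') :
    ∃ ψ : Fin T → (Fin (T+1) → Fin n → ℝ) → (Fin T → Fin q → ℝ) → Fin m → ℝ,
      (∀ (k : Fin T) (x x' : Fin (T+1) → Fin n → ℝ) (ζ ζ' : Fin T → Fin q → ℝ),
        (∀ s : Fin (T+1), (s : ℕ) ≤ (k : ℕ) → x s = x' s) →
        (∀ s : Fin T, (s : ℕ) ≤ (k : ℕ) → ζ s = ζ' s) →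
        ψ k x ζ = ψ k x' ζ') ∧
      ∀ (ξ : Fin T → Fin d → ℝ) (ζ : Fin T → Fin q → ℝ)
        (x x' : Fin (T+1) → Fin n → ℝ) (u u' : Fin T → Fin m → ℝ),
        Dyn T n m d q xInit A B D E ξ ζ x u → (∀ k, u k = Ψ k ξ ζ) →
        Dyn T n m d q xInit A B D E ξ ζ x' u' → (∀ k, u' k = ψ k x' ζ) →
        x = x' ∧ u = u' := by
  refine ⟨fun k x ζ => Ψ k ((disturbanceSweep A B D E Ψ x ζ)^[k] 0) ζ, ?_, ?_⟩
  · intro k x x' ζ ζ' hx hζ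
    exact hΨ k _ _ ζ ζ' (disturbanceSweep_iterate_congr hΨ hx hζ k) hζ
  · intro ξ ζ x x' u u' hdyn hu hdyn' hu'
    obtain rfl : u = u' := by
      funext k
      rw [hu k, hu' k]
      exact hΨ k _ _ ζ ζ
        (fun s hs => (disturbanceSweep_iterate_eq hE hΨ hdyn' hu' k s hs).symm) (fun _ _ => rfl)
    exact ⟨hdyn.state_unique hdyn', rfl⟩
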